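/- Let (Ω, μ) be a probability space, X an m × p real matrix such that XᵀX is invertible, β₀ ∈ ℝ^p, and η₀ := Xβ₀ ∈ ℝ^m. Let β̃_n : Ω → ℝ^p and η̂_n : Ω → ℝ^m be sequences of measurable maps such that β̃_n → β₀ in probability and η̂_n → η₀ in probability, and define the Jacobi estimator β̂_n := (XᵀX)⁻¹Xᵀ η̂_n. Then for every ε > 0 and every δ > 0 there exists N such that for all n ≥ N, μ{ω : ‖β̂_n(ω) − β̃_n(ω)‖ > ε} < δ. -/

import Mathlib

open MeasureTheory Filter Topology Matrix

/-- If the Gram matrix `Xᵀ * X` is invertible, then `(Xᵀ * X)⁻¹ * Xᵀ` is a left inverse of `X`. -/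
theorem toEuclideanLin_gram_inv_mul_transpose_apply {m p : ℕ} (X : Matrix (Fin m) (Fin p) ℝ)
    (hX : IsUnit (Xᵀ * X)) (β : EuclideanSpace ℝ (Fin p)) :
    Matrix.toEuclideanLin ((Xᵀ * X)⁻¹ * Xᵀ) (Matrix.toEuclideanLin X β) = β := by
  have hdet : IsUnit (Xᵀ * X).det := (Matrix.isUnit_iff_isUnit_det _).mp hX
  simp [Matrix.toLpLin_apply, Matrix.mulVec_mulVec,
    Matrix.nonsing_inv_mul _ hdet]

/-- Asymptotic equivalence of the Jacobi (projection) estimator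
`β̂ₙ = (XᵀX)⁻¹Xᵀη̂ₙ` and the posterior mode `β̃ₙ`: if `β̃ₙ → β₀` in probability and
`η̂ₙ → η₀ = Xβ₀` in probability, then `‖β̂ₙ − β̃ₙ‖ → 0` in probability. -/
theorem jacobi_estimator_asymptotic_equivalence
    {Ω : Type*} [MeasurableSpace Ω] (μ : Measure Ω) [IsProbabilityMeasure μ]
    {m p : ℕ} (X : Matrix (Fin m) (Fin p) ℝ) (hX : IsUnit (Xᵀ * X))
    (β₀ : EuclideanSpace ℝ (Fin p)) (η₀ : EuclideanSpace ℝ (Fin m))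
    (hη₀ : η₀ = Matrix.toEuclideanLin X β₀)
    (βt : ℕ → Ω → EuclideanSpace ℝ (Fin p))
    (ηh : ℕ → Ω → EuclideanSpace ℝ (Fin m))
    (hβtmeas : ∀ n, Measurable (βt n)) (hηhmeas : ∀ n, Measurable (ηh n))
    (hβt : ∀ ε > (0 : ℝ), Tendsto (fun n => μ {ω | ε < ‖βt n ω - β₀‖}) atTop (𝓝 0))
    (hηh : ∀ ε > (0 : ℝ), Tendsto (fun n => μ {ω | ε < ‖ηh n ω - η₀‖}) atTop (𝓝 0))
    (βh : ℕ → Ω → EuclideanSpace ℝ (Fin p))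
    (hβh : ∀ n ω, βh n ω = Matrix.toEuclideanLin ((Xᵀ * X)⁻¹ * Xᵀ) (ηh n ω)) :
    ∀ ε > (0 : ℝ), ∀ δ > (0 : ℝ), ∃ N : ℕ, ∀ n ≥ N,
      μ {ω | ε < ‖βh n ω - βt n ω‖} < ENNReal.ofReal δ := by
  intro ε hε δ hδ
  set L := Matrix.toEuclideanLin ((Xᵀ * X)⁻¹ * Xᵀ)
  have hL : L η₀ = β₀ := hη₀ ▸ toEuclideanLin_gram_inv_mul_transpose_apply X hX β₀
  obtain ⟨C, hC, hLC⟩ := (LinearMap.toContinuousLinearMap L).bound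
  have hsum := (hηh (ε / 2 / C) (by positivity)).add (hβt (ε / 2) (by positivity))
  rw [add_zero] at hsum
  obtain ⟨N, hN⟩ := eventually_atTop.mp
    (hsum.eventually_lt_const (ENNReal.ofReal_pos.mpr hδ))
  refine ⟨N, fun n hn => lt_of_le_of_lt ?_ (hN n hn)⟩
  refine (measure_mono fun ω hω => ?_).trans (measure_union_le _ _)
  simp only [Set.mem_union, Set.mem_ofPred_eq] at hω ⊢
  by_contra! h
  obtain ⟨hη, hβ⟩ := h
  have hbound : ‖βh n ω - β₀‖ ≤ C * ‖ηh n ω - η₀‖ := by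
    simpa [hβh, hL] using hLC (ηh n ω - η₀)
  have hmul : ‖ηh n ω - η₀‖ * C ≤ ε / 2 := (le_div_iff₀ hC).mp hη
  have htri := norm_sub_le_norm_sub_add_norm_sub (βh n ω) β₀ (βt n ω)
  rw [norm_sub_rev β₀] at htri
  linarith
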